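/- arXiv:math/0107016 — 3 statements merged into one kernel-verified Lean document; each statement's English description precedes it below -/
import Mathlib

section
/- The sets S1 and S2 have disjoint interiors: interior(S1) ∩ interior(S2) = ∅. -/
/-- The closed unit cube `[-1/2, 1/2]³` centered at the origin in `ℝ³`. -/
def unitCube : Set (Fin 3 → ℝ) := {x | ∀ i, x i ∈ Set.Icc (-(1/2) : ℝ) (1/2)}

/-- `L1`: integer points with at most one odd coordinate. -/
def L1 : Set (Fin 3 → ℤ) := {p | ∀ i j, Odd (p i) → Odd (p j) → i = j}

/-- `L2`: integer points with at most one even coordinate. -/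
def L2 : Set (Fin 3 → ℤ) := {p | ∀ i j, Even (p i) → Even (p j) → i = j}

/-- `S1`: the union of the cubes centered at points of `L1`. -/
def S1 : Set (Fin 3 → ℝ) := ⋃ p ∈ L1, (fun c => c + fun i => (p i : ℝ)) '' unitCube

/-- `S2`: the union of the cubes centered at points of `L2`. -/
def S2 : Set (Fin 3 → ℝ) := ⋃ p ∈ L2, (fun c => c + fun i => (p i : ℝ)) '' unitCube

/-- An irrational number lies within `1/2` of at most one integer. -/
lemma Irrational.int_eq_of_sub_mem_Icc {x : ℝ} (hx : Irrational x) {m n : ℤ}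
    (hm : x - m ∈ Set.Icc (-(1/2) : ℝ) (1/2)) (hn : x - n ∈ Set.Icc (-(1/2) : ℝ) (1/2)) :
    m = n := by
  have ne_add_half (k : ℤ) : x ≠ k + 1/2 := fun h => hx ⟨k + 1/2, by push_cast; exact h.symm⟩
  obtain ⟨hm₁, hm₂⟩ := hm
  obtain ⟨hn₁, hn₂⟩ := hn
  have hm₃ : x < m + 1/2 := lt_of_le_of_ne (by linarith) (ne_add_half m)
  have hn₃ : x < n + 1/2 := lt_of_le_of_ne (by linarith) (ne_add_half n)
  have hmn : (m : ℝ) < n + 1 := by linarith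
  have hnm : (n : ℝ) < m + 1 := by linarith
  norm_cast at hmn hnm
  lia

lemma disjoint_L1_L2 : Disjoint L1 L2 := by
  refine Set.disjoint_left.2 fun p h₁ h₂ => ?_
  have pairs (i j : Fin 3) (hij : i ≠ j) : ¬(Odd (p i) ↔ Odd (p j)) := fun h => by
    rcases Int.even_or_odd (p i) with hi | hi
    · exact hij (h₂ i j hi (by rwa [← Int.not_odd_iff_even, ← h, Int.not_odd_iff_even]))
    · exact hij (h₁ i j hi (h.1 hi))
  have := pairs 0 1 (by decide)
  have := pairs 1 2 (by decide)
  have := pairs 0 2 (by decide)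
  tauto

lemma dense_setOf_forall_irrational {ι : Type*} : Dense {x : ι → ℝ | ∀ i, Irrational (x i)} := by
  simpa [Set.pi] using dense_pi Set.univ fun (_ : ι) _ => dense_irrational

/-- `S1` and `S2` have disjoint interiors. -/
theorem interior_S1_inter_interior_S2 : interior S1 ∩ interior S2 = ∅ := by
  by_contra h
  obtain ⟨x, ⟨hx₁, hx₂⟩, hx⟩ := dense_setOf_forall_irrational.inter_open_nonempty _
    (isOpen_interior.inter isOpen_interior) (Set.nonempty_iff_ne_empty.2 h)
  have hS₁ := interior_subset hx₁
  have hS₂ := interior_subset hx₂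
  simp only [S1, S2, Set.mem_iUnion] at hS₁ hS₂
  obtain ⟨p, hp, c, hc, hpc⟩ := hS₁
  obtain ⟨q, hq, d, hd, hqd⟩ := hS₂
  have hpq : p = q := funext fun i => (hx i).int_eq_of_sub_mem_Icc
    (by simpa [← hpc] using hc i) (by simpa [← hqd] using hd i)
  exact Set.disjoint_left.1 disjoint_L1_L2 hp (hpq ▸ hq)
end

section
/- The doubled grid is contained in S1: 2G ⊆ S1, i.e., every point of ℝ³ having at least two coordinates that are even integers lies in S1. -/
/-- The doubled grid `2G`: points of `ℝ³` having at least two coordinates that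
are even integers. -/
def doubledGrid : Set (Fin 3 → ℝ) :=
  {x | ∃ i j : Fin 3, i ≠ j ∧ (∃ m : ℤ, x i = 2 * m) ∧ (∃ m : ℤ, x j = 2 * m)}

/-- The doubled grid is contained in `S1`. -/
theorem doubledGrid_subset_S1 : doubledGrid ⊆ S1 := by
  rintro x ⟨i, j, hij, ⟨m, hm⟩, ⟨n, hn⟩⟩
  have round_even {k : Fin 3} {l : ℤ} (h : x k = 2 * l) : ¬ Odd (round (x k)) := by
    have hl : x k = ((2 * l : ℤ) : ℝ) := by push_cast; exact h
    rw [hl, round_intCast, Int.not_odd_iff_even]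
    exact even_two_mul l
  have hi := round_even hm
  have hj := round_even hn
  refine Set.mem_iUnion₂.2 ⟨fun k => round (x k), fun a b ha hb => ?_,
    fun k => x k - round (x k), fun k => abs_le.1 (abs_sub_round (x k)), ?_⟩
  · have hai : a ≠ i := by rintro rfl; exact hi ha
    have haj : a ≠ j := by rintro rfl; exact hj ha
    have hbi : b ≠ i := by rintro rfl; exact hi hb
    have hbj : b ≠ j := by rintro rfl; exact hj hb
    omega
  · ext k
    simp
end

section
/- S1 is path-connected. -/
theorem mem_L1_of_even {p : Fin 3 → ℤ} {i : Fin 3} (hp : ∀ j ≠ i, Even (p j)) : p ∈ L1 := by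
  have key : ∀ j, Odd (p j) → j = i := fun j hj => by
    by_contra h
    exact Int.not_even_iff_odd.mpr hj (hp j h)
  exact fun j k hj hk => (key j hj).trans (key k hk).symm

theorem exists_even_of_mem_L1 {p : Fin 3 → ℤ} (hp : p ∈ L1) : ∃ i, ∀ j ≠ i, Even (p j) := by
  by_cases h : ∃ i, Odd (p i)
  · obtain ⟨i, hi⟩ := h
    exact ⟨i, fun j hj => Int.not_odd_iff_even.mp fun hodd => hj (hp j i hodd hi)⟩
  · push Not at h
    exact ⟨0, fun j _ => Int.not_odd_iff_even.mp (by simpa using h j)⟩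

theorem mem_S1_iff {x : Fin 3 → ℝ} : x ∈ S1 ↔ ∃ p ∈ L1, ∀ i, |x i - p i| ≤ 1 / 2 := by
  simp only [S1, Set.mem_iUnion, Set.mem_image, exists_prop, unitCube, Set.mem_ofPred_eq,
    Set.mem_Icc, ← abs_le]
  refine exists_congr fun p => and_congr_right fun _ => ⟨?_, fun h => ?_⟩
  · rintro ⟨c, hc, rfl⟩ i
    simpa using hc i
  · exact ⟨fun i => x i - p i, h, by ext i; simp⟩

theorem joinedIn_S1_of_abs_le {x : Fin 3 → ℝ} {p : Fin 3 → ℤ} (hp : p ∈ L1)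
    (hx : ∀ i, |x i - p i| ≤ 1 / 2) : JoinedIn S1 x (fun i => (p i : ℝ)) := by
  refine JoinedIn.of_segment_subset ?_
  rintro _ ⟨a, b, ha, hb, hab, rfl⟩
  refine mem_S1_iff.mpr ⟨p, hp, fun i => ?_⟩
  have : (a • x + b • fun i => (p i : ℝ)) i - p i = a * (x i - p i) := by
    simp only [Pi.add_apply, Pi.smul_apply, smul_eq_mul]
    linear_combination (p i : ℝ) * hab
  rw [this, abs_mul, abs_of_nonneg ha]
  nlinarith [hx i, abs_nonneg (x i - p i)]

/-- If all coordinates of `p` other than the `i`-th are even, the `i`-th one can be changed at will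
within `S1`. -/
theorem joinedIn_S1_update {p : Fin 3 → ℤ} {i : Fin 3} (hp : ∀ j ≠ i, Even (p j)) (n : ℤ) :
    JoinedIn S1 (fun j => (p j : ℝ)) (fun j => (Function.update p i n j : ℝ)) := by
  refine JoinedIn.of_segment_subset ?_
  rintro y ⟨a, b, ha, hb, hab, rfl⟩
  set y : Fin 3 → ℝ := a • (fun j => (p j : ℝ)) + b • fun j => (Function.update p i n j : ℝ)
    with hy
  refine mem_S1_iff.mpr ⟨Function.update p i (round (y i)), mem_L1_of_even (i := i) ?_, ?_⟩
  · intro j hj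
    simpa [hj] using hp j hj
  · intro j
    by_cases hj : j = i
    · subst hj
      simpa using abs_sub_round (y j)
    · have : y j = p j := by
        simp only [hy, Pi.add_apply, Pi.smul_apply, smul_eq_mul, Function.update_of_ne hj]
        linear_combination (p j : ℝ) * hab
      simp [hj, this]

theorem joinedIn_S1_zero_of_mem_L1 {p : Fin 3 → ℤ} (hp : p ∈ L1) :
    JoinedIn S1 (fun j => (p j : ℝ)) 0 := by
  obtain ⟨i, hi⟩ := exists_even_of_mem_L1 hp
  have even_update : ∀ (q : Fin 3 → ℤ) (k : Fin 3), (∀ j ≠ k, Even (q j)) →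
      ∀ j, Even (Function.update q k 0 j) := fun q k hq j => by
    by_cases hj : j = k
    · simp [hj]
    · simpa [hj] using hq j hj
  have h := even_update p i hi
  have h0 := even_update _ 0 fun j _ => h j
  have h1 := even_update _ 1 fun j _ => h0 j
  convert (((joinedIn_S1_update hi 0).trans (joinedIn_S1_update (fun j _ => h j) 0)).trans
    (joinedIn_S1_update (fun j _ => h0 j) 0)).trans
    (joinedIn_S1_update (i := 2) (fun j _ => h1 j) 0) using 1
  ext j
  fin_cases j <;> simp [Function.update]

/-- `S1` is path-connected. -/
theorem S1_pathConnected : IsPathConnected S1 := by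
  refine ⟨0, mem_S1_iff.mpr ⟨0, fun i j h => by simp at h, by simp⟩, fun {x} hx => ?_⟩
  obtain ⟨p, hp, hxp⟩ := mem_S1_iff.mp hx
  exact ((joinedIn_S1_of_abs_le hp hxp).trans (joinedIn_S1_zero_of_mem_L1 hp)).symm
end
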